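/- Let f(x, W) = f̃(W₁x, W₂) with f̃ differentiable, let x₁, …, xₙ ∈ ℝ^d be nonzero training inputs, let W* = (W₁*, W₂*) be an interpolation solution, and let the total number of parameters be w. Suppose the k-th order linear stability moment bound holds at W*: (1/n) Σᵢ₌₁ⁿ (∂f/∂W_j (xᵢ, W*))^{2k} ≤ 2^k B^{k−1}/η^k for every parameter coordinate j (equivalently (1/n) Σᵢ ‖∇_W f(xᵢ, W*)‖_{2k}^{2k} ≤ 2w(2B)^{k−1}/η^k). Then |f(·, W*)|_{1,2k,{xᵢ}} ≤ (‖(W₁*)ᵀ‖_{2k} / min_{1≤i≤n} ‖xᵢ‖_{2k}) · (w/B)^{1/(2k)} · √(2B/η). -/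

import Mathlib

/-- Matrix–vector product of `W : ℝ^{m×d}` (as a function) with `x : ℝ^d`. -/
noncomputable def mVec {m d : ℕ} (W : Fin m → Fin d → ℝ) (x : Fin d → ℝ) : Fin m → ℝ :=
  fun r => ∑ s, W r s * x s

/-- ℓ^{2k} norm of a vector. -/
noncomputable def lpnorm (k : ℕ) {d : ℕ} (v : Fin d → ℝ) : ℝ :=
  (∑ j, |v j| ^ (2 * k)) ^ ((2 * k : ℝ))⁻¹

/-- Operator norm of a matrix induced by ℓ^{2k} norms on domain and codomain. -/
noncomputable def opNormP (k : ℕ) {m d : ℕ} (W : Fin m → Fin d → ℝ) : ℝ :=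
  sSup {r : ℝ | ∃ x : Fin d → ℝ, lpnorm k x = 1 ∧ r = lpnorm k (mVec W x)}

theorem sum_abs_pow_nonneg (k : ℕ) {d : ℕ} (v : Fin d → ℝ) : 0 ≤ ∑ j, |v j| ^ (2 * k) :=
  Finset.sum_nonneg fun _ _ => by positivity

theorem lpnorm_nonneg (k : ℕ) {d : ℕ} (v : Fin d → ℝ) : 0 ≤ lpnorm k v :=
  Real.rpow_nonneg (sum_abs_pow_nonneg k v) _

theorem rpow_inv_two_mul_pow {k : ℕ} (hk : 1 ≤ k) {a : ℝ} (ha : 0 ≤ a) :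
    (a ^ ((2 * k : ℝ))⁻¹) ^ (2 * k) = a := by
  have h := Real.rpow_inv_natCast_pow ha (n := 2 * k) (by omega)
  push_cast at h
  exact h

theorem lpnorm_pow {k : ℕ} (hk : 1 ≤ k) {d : ℕ} (v : Fin d → ℝ) :
    lpnorm k v ^ (2 * k) = ∑ j, |v j| ^ (2 * k) :=
  rpow_inv_two_mul_pow hk (sum_abs_pow_nonneg k v)

theorem lpnorm_pos (k : ℕ) {d : ℕ} {v : Fin d → ℝ} (hv : v ≠ 0) :
    0 < lpnorm k v := by
  obtain ⟨j, hj⟩ := Function.ne_iff.mp hv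
  refine Real.rpow_pos_of_pos (Finset.sum_pos' (fun _ _ => by positivity)
    ⟨j, Finset.mem_univ _, pow_pos (abs_pos.mpr hj) _⟩) _

theorem lpnorm_smul {k : ℕ} (hk : 1 ≤ k) {d : ℕ} (c : ℝ) (v : Fin d → ℝ) :
    lpnorm k (c • v) = |c| * lpnorm k v := by
  refine (pow_left_inj₀ (lpnorm_nonneg _ _) (mul_nonneg (abs_nonneg _) (lpnorm_nonneg _ _))
    (n := 2 * k) (by omega)).mp ?_
  rw [mul_pow, lpnorm_pow hk, lpnorm_pow hk, Finset.mul_sum]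
  simp [abs_mul, mul_pow]

theorem mVec_smul {m d : ℕ} (W : Fin m → Fin d → ℝ) (c : ℝ) (v : Fin d → ℝ) :
    mVec W (c • v) = c • mVec W v := by
  ext r
  simp only [mVec, Pi.smul_apply, smul_eq_mul, Finset.mul_sum]
  exact Finset.sum_congr rfl fun _ _ => by ring

theorem abs_le_lpnorm {k : ℕ} (hk : 1 ≤ k) {d : ℕ} (v : Fin d → ℝ) (j : Fin d) :
    |v j| ≤ lpnorm k v := by
  refine le_of_pow_le_pow_left₀ (n := 2 * k) (by omega) (lpnorm_nonneg _ _) ?_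
  rw [lpnorm_pow hk]
  exact Finset.single_le_sum (f := fun j => |v j| ^ (2 * k)) (fun _ _ => by positivity)
    (Finset.mem_univ j)

theorem bddAbove_opNormP_set {k : ℕ} (hk : 1 ≤ k) {m d : ℕ} (W : Fin m → Fin d → ℝ) :
    BddAbove {r : ℝ | ∃ x : Fin d → ℝ, lpnorm k x = 1 ∧ r = lpnorm k (mVec W x)} := by
  refine ⟨lpnorm k (fun r => ∑ s, |W r s|), ?_⟩
  rintro _ ⟨x, hx, rfl⟩
  refine Real.rpow_le_rpow (sum_abs_pow_nonneg k _) ?_ (by positivity)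
  refine Finset.sum_le_sum fun r _ => pow_le_pow_left₀ (abs_nonneg _) ?_ _
  refine (Finset.abs_sum_le_sum_abs _ _).trans ((Finset.sum_le_sum fun s _ => ?_).trans
    (le_abs_self _))
  rw [abs_mul]
  exact mul_le_of_le_one_right (abs_nonneg _) (hx ▸ abs_le_lpnorm hk x s)

theorem opNormP_nonneg (k : ℕ) {m d : ℕ} (W : Fin m → Fin d → ℝ) : 0 ≤ opNormP k W := by
  refine Real.sSup_nonneg ?_
  rintro _ ⟨x, -, rfl⟩
  exact lpnorm_nonneg _ _

theorem lpnorm_mVec_le {k : ℕ} (hk : 1 ≤ k) {m d : ℕ} (W : Fin m → Fin d → ℝ)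
    (v : Fin d → ℝ) : lpnorm k (mVec W v) ≤ opNormP k W * lpnorm k v := by
  rcases eq_or_ne v 0 with rfl | hv
  · have h : mVec W 0 = (0 : ℝ) • mVec W 0 := by rw [← mVec_smul, smul_zero]
    rw [h, lpnorm_smul hk, abs_zero, zero_mul]
    exact mul_nonneg (opNormP_nonneg _ _) (lpnorm_nonneg _ _)
  · have hpos := lpnorm_pos k hv
    rw [← div_le_iff₀ hpos]
    refine le_csSup (bddAbove_opNormP_set hk W) ⟨(lpnorm k v)⁻¹ • v, ?_, ?_⟩
    · rw [lpnorm_smul hk, abs_of_pos (inv_pos.mpr hpos), inv_mul_cancel₀ hpos.ne']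
    · rw [mVec_smul, lpnorm_smul hk, abs_of_pos (inv_pos.mpr hpos), div_eq_inv_mul]

/-- The map `W₁ ↦ W₁ x` as a continuous linear map. -/
noncomputable def mVecLeft {m d : ℕ} (x : Fin d → ℝ) :
    (Fin m → Fin d → ℝ) →L[ℝ] (Fin m → ℝ) :=
  LinearMap.toContinuousLinearMap
    { toFun := fun W => mVec W x
      map_add' := fun V W => by
        ext r
        simp [mVec, add_mul, Finset.sum_add_distrib]
      map_smul' := fun c W => by
        ext r
        simp [mVec, Finset.mul_sum, mul_assoc] }

/-- The map `x ↦ W₁ x` as a continuous linear map. -/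
noncomputable def mVecRight {m d : ℕ} (W : Fin m → Fin d → ℝ) :
    (Fin d → ℝ) →L[ℝ] (Fin m → ℝ) :=
  LinearMap.toContinuousLinearMap
    { toFun := mVec W
      map_add' := fun u v => by
        ext r
        simp [mVec, mul_add, Finset.sum_add_distrib]
      map_smul' := mVec_smul W }

section Gradients

variable {m d p : ℕ} {ft : (Fin m → ℝ) → (Fin p → ℝ) → ℝ}

/-- Gradient of `ft` with respect to its first argument. -/
noncomputable def gradFst (ft : (Fin m → ℝ) → (Fin p → ℝ) → ℝ) (u : Fin m → ℝ)
    (v : Fin p → ℝ) : Fin m → ℝ :=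
  fun r => fderiv ℝ (fun q : (Fin m → ℝ) × (Fin p → ℝ) => ft q.1 q.2) (u, v) (Pi.single r 1, 0)

theorem fderiv_firstLayer_apply
    (hft : Differentiable ℝ (fun q : (Fin m → ℝ) × (Fin p → ℝ) => ft q.1 q.2))
    (x : Fin d → ℝ) (W : (Fin m → Fin d → ℝ) × (Fin p → ℝ)) (r : Fin m) (s : Fin d) :
    fderiv ℝ (fun V : (Fin m → Fin d → ℝ) × (Fin p → ℝ) => ft (mVec V.1 x) V.2) W
        (Pi.single r (Pi.single s 1), 0) = x s * gradFst ft (mVec W.1 x) W.2 r := by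
  have h : HasFDerivAt (fun V : (Fin m → Fin d → ℝ) × (Fin p → ℝ) => ft (mVec V.1 x) V.2)
      _ W := HasFDerivAt.comp
      (g := fun q : (Fin m → ℝ) × (Fin p → ℝ) => ft q.1 q.2) W (hft (mVec W.1 x, W.2)).hasFDerivAt
    ((mVecLeft x).prodMap (ContinuousLinearMap.id ℝ (Fin p → ℝ))).hasFDerivAt
  have hs : ((mVecLeft x).prodMap (ContinuousLinearMap.id ℝ (Fin p → ℝ)))
      (Pi.single r (Pi.single s 1), 0) = x s • ((Pi.single r 1, 0) :
        (Fin m → ℝ) × (Fin p → ℝ)) := by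
    refine Prod.ext ?_ (by simp)
    ext t
    rcases eq_or_ne t r with rfl | ht
    · simp [mVecLeft, mVec, Pi.single_apply]
    · simp [mVecLeft, mVec, ht]
  rw [h.fderiv, ContinuousLinearMap.comp_apply, hs, map_smul, smul_eq_mul, gradFst]

theorem fderiv_input_apply
    (hft : Differentiable ℝ (fun q : (Fin m → ℝ) × (Fin p → ℝ) => ft q.1 q.2))
    (x : Fin d → ℝ) (W : (Fin m → Fin d → ℝ) × (Fin p → ℝ)) (j : Fin d) :
    fderiv ℝ (fun z => ft (mVec W.1 z) W.2) x (Pi.single j 1) =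
      mVec (fun s r => W.1 r s) (gradFst ft (mVec W.1 x) W.2) j := by
  have h : HasFDerivAt (fun z => ft (mVec W.1 z) W.2) _ x :=
    HasFDerivAt.comp
      (g := fun q : (Fin m → ℝ) × (Fin p → ℝ) => ft q.1 q.2) x (hft (mVec W.1 x, W.2)).hasFDerivAt
      ((mVecRight W.1).hasFDerivAt.prodMk (hasFDerivAt_const W.2 x))
  have hs : ((mVecRight W.1).prod (0 : (Fin d → ℝ) →L[ℝ] (Fin p → ℝ))) (Pi.single j 1) =
      ∑ r, W.1 r j • ((Pi.single r 1, 0) : (Fin m → ℝ) × (Fin p → ℝ)) := by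
    refine Prod.ext ?_ (by simp [Prod.snd_sum])
    ext t
    simp [Prod.fst_sum, Finset.sum_apply, mVecRight, mVec, Pi.single_apply]
  rw [h.fderiv, ContinuousLinearMap.comp_apply, hs, map_sum]
  simp only [map_smul, smul_eq_mul, mVec, gradFst]

end Gradients

/-- at an interpolation solution satisfying the `k`-th order linear stability
moment bounds of SGD (learning rate `η`, batch size `B`) in every parameter coordinate, the
discrete Sobolev seminorm of the model on the training data satisfies
`|f(·,W*)|_{1,2k,{xᵢ}} ≤ (‖(W₁*)ᵀ‖_{2k}/minᵢ‖xᵢ‖_{2k}) (w/B)^{1/(2k)} √(2B/η)`,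
with `w = md + p` the total number of parameters. -/
theorem sobolev_seminorm_bound_of_stability
    {m d p n : ℕ} (hn : 0 < n) (B k : ℕ) (hk : 1 ≤ k) (hB : 1 ≤ B)
    (η : ℝ) (hη : 0 < η)
    (ft : (Fin m → ℝ) → (Fin p → ℝ) → ℝ)
    (hft : Differentiable ℝ (fun q : (Fin m → ℝ) × (Fin p → ℝ) => ft q.1 q.2))
    (x : Fin n → Fin d → ℝ) (hx : ∀ i, x i ≠ 0) (y : Fin n → ℝ)
    (Wstar : (Fin m → Fin d → ℝ) × (Fin p → ℝ))
    (hinterp : ∀ i, ft (mVec Wstar.1 (x i)) Wstar.2 = y i)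
    (hmom1 : ∀ (r : Fin m) (s : Fin d),
      (1 / (n : ℝ)) * ∑ i,
          (fderiv ℝ (fun V : (Fin m → Fin d → ℝ) × (Fin p → ℝ) => ft (mVec V.1 (x i)) V.2)
            Wstar (Pi.single r (Pi.single s 1), 0)) ^ (2 * k)
        ≤ 2 ^ k * (B : ℝ) ^ (k - 1) / η ^ k)
    (hmom2 : ∀ l : Fin p,
      (1 / (n : ℝ)) * ∑ i,
          (fderiv ℝ (fun V : (Fin m → Fin d → ℝ) × (Fin p → ℝ) => ft (mVec V.1 (x i)) V.2)
            Wstar (0, Pi.single l 1)) ^ (2 * k)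
        ≤ 2 ^ k * (B : ℝ) ^ (k - 1) / η ^ k) :
    ((1 / (n : ℝ)) * ∑ i, ∑ j,
        |fderiv ℝ (fun z => ft (mVec Wstar.1 z) Wstar.2) (x i) (Pi.single j 1)| ^ (2 * k))
          ^ ((2 * k : ℝ))⁻¹
      ≤ (opNormP k (fun s r => Wstar.1 r s) /
          Finset.univ.inf' ⟨⟨0, hn⟩, Finset.mem_univ _⟩ (fun i => lpnorm k (x i))) *
        (((m * d + p : ℕ) : ℝ) / (B : ℝ)) ^ ((2 * k : ℝ))⁻¹ *
        Real.sqrt (2 * (B : ℝ) / η) := by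
  set g : Fin n → Fin m → ℝ := fun i => gradFst ft (mVec Wstar.1 (x i)) Wstar.2 with hg
  set op := opNormP k (fun s r => Wstar.1 r s) with hop_def
  set μ := Finset.univ.inf' ⟨⟨0, hn⟩, Finset.mem_univ _⟩ (fun i => lpnorm k (x i)) with hμ_def
  set C : ℝ := 2 ^ k * (B : ℝ) ^ (k - 1) / η ^ k with hC_def
  have hB0 : (0 : ℝ) < B := by exact_mod_cast hB
  have hn0 : (0 : ℝ) < n := by exact_mod_cast hn
  have hC : 0 ≤ C := by positivity
  have hop : 0 ≤ op := opNormP_nonneg _ _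
  have hμ : 0 < μ := (Finset.lt_inf'_iff _).mpr fun i _ => lpnorm_pos k (hx i)
  have hμ_le : ∀ i, μ ≤ lpnorm k (x i) := fun i => Finset.inf'_le _ (Finset.mem_univ i)
  have hgrad : (1 / (n : ℝ)) * ∑ i, (lpnorm k (x i) * lpnorm k (g i)) ^ (2 * k)
      ≤ (m * d : ℕ) * C := by
    have hsum := Finset.sum_le_sum fun (r : Fin m) (_ : r ∈ Finset.univ) =>
      Finset.sum_le_sum fun (s : Fin d) (_ : s ∈ Finset.univ) => hmom1 r s
    simp only [Finset.sum_const, Finset.card_univ, Fintype.card_fin, nsmul_eq_mul,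
      ← Finset.mul_sum, fderiv_firstLayer_apply hft] at hsum
    calc (1 / (n : ℝ)) * ∑ i, (lpnorm k (x i) * lpnorm k (g i)) ^ (2 * k)
        = (1 / (n : ℝ)) * ∑ r, ∑ s, ∑ i, (x i s * g i r) ^ (2 * k) := by
          congr 1
          simp only [mul_pow, lpnorm_pow hk, Finset.sum_mul_sum, Even.pow_abs (even_two_mul k)]
          rw [Finset.sum_congr rfl fun _ _ => Finset.sum_comm, Finset.sum_comm]
          exact Finset.sum_congr rfl fun _ _ => Finset.sum_comm
      _ ≤ m * (d * C) := hsum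
      _ = (m * d : ℕ) * C := by push_cast; ring
  have hmean : (1 / (n : ℝ)) * ∑ i, lpnorm k (g i) ^ (2 * k) ≤
      (m * d + p : ℕ) * C / μ ^ (2 * k) := by
    rw [le_div_iff₀ (by positivity)]
    calc (1 / (n : ℝ)) * (∑ i, lpnorm k (g i) ^ (2 * k)) * μ ^ (2 * k)
        = (1 / (n : ℝ)) * ∑ i, (μ * lpnorm k (g i)) ^ (2 * k) := by
          simp only [mul_pow, ← Finset.mul_sum]; ring
      _ ≤ (1 / (n : ℝ)) * ∑ i, (lpnorm k (x i) * lpnorm k (g i)) ^ (2 * k) := by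
          gcongr with i
          · exact mul_nonneg hμ.le (lpnorm_nonneg _ _)
          · exact lpnorm_nonneg _ _
          · exact hμ_le i
      _ ≤ (m * d : ℕ) * C := hgrad
      _ ≤ (m * d + p : ℕ) * C := by gcongr; omega
  have hRHS : ((op / μ) * (((m * d + p : ℕ) : ℝ) / (B : ℝ)) ^ ((2 * k : ℝ))⁻¹ *
      Real.sqrt (2 * (B : ℝ) / η)) ^ (2 * k) =
      op ^ (2 * k) * ((m * d + p : ℕ) * C / μ ^ (2 * k)) := by
    rw [mul_pow, mul_pow, rpow_inv_two_mul_pow hk (by positivity), pow_mul (Real.sqrt _),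
      Real.sq_sqrt (by positivity), hC_def]
    obtain ⟨l, rfl⟩ : ∃ l, k = l + 1 := ⟨k - 1, by omega⟩
    simp only [Nat.add_sub_cancel, div_pow, mul_pow, pow_succ (B : ℝ)]
    field_simp
  refine le_of_pow_le_pow_left₀ (n := 2 * k) (by omega) (by positivity) ?_
  rw [hRHS, rpow_inv_two_mul_pow hk (by positivity)]
  calc _ = (1 / (n : ℝ)) * ∑ i, lpnorm k (mVec (fun s r => Wstar.1 r s) (g i)) ^ (2 * k) := by
        simp only [fderiv_input_apply hft, lpnorm_pow hk, hg]
    _ ≤ (1 / (n : ℝ)) * ∑ i, (op * lpnorm k (g i)) ^ (2 * k) := by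
        gcongr with i
        · exact lpnorm_nonneg _ _
        · exact lpnorm_mVec_le hk _ _
    _ = op ^ (2 * k) * ((1 / (n : ℝ)) * ∑ i, lpnorm k (g i) ^ (2 * k)) := by
        simp only [mul_pow, ← Finset.mul_sum]; ring
    _ ≤ _ := by gcongr
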